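/- arXiv:2207.09304 — 3 statements merged into one kernel-verified Lean document; each statement's English description precedes it below -/
import Mathlib

section
/- Let T > 0, A_0 > 0, c_0 > 0 and c_1 ≥ 0. Let u : [0,T] → ℝ be nonnegative and differentiable, let I : [0,T] → ℝ be nonnegative and continuous, and suppose u'(s) ≤ −c_0 I(s) + c_1 for all s ∈ [0,T]. Let f : [0,T] → ℝ be nonnegative and differentiable with f' ≤ 0. Then ∫_0^T e^{−A_0(T−s)} f(s) I(s) ds ≤ (1/c_0) [ f(0) e^{−A_0 T} u(0) + ( c_1 + A_0 · sup_{s∈[0,T]} u(s) ) ∫_0^T e^{−A_0(T−s)} f(s) ds ]. -/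
open MeasureTheory intervalIntegral

/-- **Exponentially weighted integration-by-parts estimate** (core of
Lemma 3.4). If `u ≥ 0` is differentiable with `u' ≤ −c₀ I + c₁` for a
nonnegative continuous `I`, and `f ≥ 0` is differentiable and nonincreasing,
then the exponentially weighted integral of `f·I` is controlled by
`u(0)`, `c₁` and `sup u`. -/
theorem weighted_fisher_integral_bound
    (T A0 c0 c1 : ℝ) (hT : 0 < T) (hA0 : 0 < A0) (hc0 : 0 < c0) (hc1 : 0 ≤ c1)
    (u u' I f f' : ℝ → ℝ)
    (hu_nonneg : ∀ s ∈ Set.Icc (0:ℝ) T, 0 ≤ u s)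
    (hu_deriv : ∀ s ∈ Set.Icc (0:ℝ) T, HasDerivAt u (u' s) s)
    (hI_nonneg : ∀ s ∈ Set.Icc (0:ℝ) T, 0 ≤ I s)
    (hI_cont : ContinuousOn I (Set.Icc (0:ℝ) T))
    (hdiff_ineq : ∀ s ∈ Set.Icc (0:ℝ) T, u' s ≤ -c0 * I s + c1)
    (hf_nonneg : ∀ s ∈ Set.Icc (0:ℝ) T, 0 ≤ f s)
    (hf_deriv : ∀ s ∈ Set.Icc (0:ℝ) T, HasDerivAt f (f' s) s)
    (hf_decr : ∀ s ∈ Set.Icc (0:ℝ) T, f' s ≤ 0) :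
    ∫ s in (0:ℝ)..T, Real.exp (-A0 * (T - s)) * (f s * I s)
      ≤ (1 / c0) *
        (f 0 * Real.exp (-A0 * T) * u 0 +
          (c1 + A0 * sSup (u '' Set.Icc (0:ℝ) T)) *
            ∫ s in (0:ℝ)..T, Real.exp (-A0 * (T - s)) * f s) := by
  set M := sSup (u '' Set.Icc (0:ℝ) T)
  have hu_cont : ContinuousOn u (Set.Icc 0 T) := HasDerivAt.continuousOn hu_deriv
  have hf_cont : ContinuousOn f (Set.Icc 0 T) := HasDerivAt.continuousOn hf_deriv
  have hexp_cont : ContinuousOn (fun s : ℝ => Real.exp (-A0 * (T - s))) (Set.Icc 0 T) := by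
    fun_prop
  have hu_le (s : ℝ) (hs : s ∈ Set.Icc (0:ℝ) T) : u s ≤ M :=
    le_csSup (isCompact_Icc.bddAbove_image hu_cont) (Set.mem_image_of_mem u hs)
  have hexp_deriv (s : ℝ) : HasDerivAt (fun s : ℝ => Real.exp (-A0 * (T - s)))
      (Real.exp (-A0 * (T - s)) * A0) s := by
    simpa using (((hasDerivAt_id s).const_sub T).const_mul (-A0)).exp
  have hef_cont : ContinuousOn (fun s => Real.exp (-A0 * (T - s)) * f s) (Set.Icc 0 T) :=
    hexp_cont.mul hf_cont
  have hefI_cont : ContinuousOn (fun s => Real.exp (-A0 * (T - s)) * (f s * I s))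
      (Set.Icc 0 T) := hexp_cont.mul (hf_cont.mul hI_cont)
  have key := sub_le_integral_of_hasDeriv_right_of_le hT.le
    (g := fun s => Real.exp (-A0 * (T - s)) * f s * u s)
    (φ := fun s => (c1 + A0 * M) * (Real.exp (-A0 * (T - s)) * f s) -
      c0 * (Real.exp (-A0 * (T - s)) * (f s * I s)))
    (hef_cont.mul hu_cont)
    (fun s hs => (((hexp_deriv s).mul (hf_deriv s (Set.Ioo_subset_Icc_self hs))).mul
      (hu_deriv s (Set.Ioo_subset_Icc_self hs))).hasDerivWithinAt)
    ((hef_cont.const_mul _).sub (hefI_cont.const_mul _)).integrableOn_Icc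
    (fun s hs => by
      have hs := Set.Ioo_subset_Icc_self hs
      have hE := (Real.exp_pos (-A0 * (T - s))).le
      have hEf := mul_nonneg hE (hf_nonneg s hs)
      have hEf' := mul_nonneg (mul_nonneg hE (neg_nonneg.2 (hf_decr s hs))) (hu_nonneg s hs)
      have hEfu := mul_le_mul_of_nonneg_left (hu_le s hs) (mul_nonneg hA0.le hEf)
      have hEfu' := mul_le_mul_of_nonneg_left (hdiff_ineq s hs) hEf
      simp only [Pi.mul_apply]
      linarith)
  rw [intervalIntegral.integral_sub
      ((hef_cont.const_mul _).intervalIntegrable_of_Icc hT.le)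
      ((hefI_cont.const_mul _).intervalIntegrable_of_Icc hT.le),
    intervalIntegral.integral_const_mul, intervalIntegral.integral_const_mul] at key
  have hT_mem : T ∈ Set.Icc (0:ℝ) T := Set.right_mem_Icc.2 hT.le
  have hend := mul_nonneg (mul_nonneg (Real.exp_pos (-A0 * (T - T))).le (hf_nonneg T hT_mem))
    (hu_nonneg T hT_mem)
  rw [one_div, ← div_eq_inv_mul, le_div_iff₀ hc0]
  simp only [sub_zero] at key
  linarith
end

section
/- For every integer k ≥ 1 and every η ∈ (0,1) satisfying kη² ≤ 2, one has e^{−kη} − (1−η)^k ≥ (1/4) k η² e^{−kη}. -/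
/-- Second-order bound obtained by truncating the series of `-log (1 - x)`. -/
theorem one_sub_le_exp_neg_sub_sq_div_two {x : ℝ} (hx0 : 0 ≤ x) (hx1 : x < 1) :
    1 - x ≤ Real.exp (-x - x ^ 2 / 2) := by
  have h := sum_le_hasSum (Finset.range 2) (fun n _ => by positivity)
    (Real.hasSum_pow_div_log_of_abs_lt_one (by rwa [abs_of_nonneg hx0]))
  norm_num [Finset.sum_range_succ] at h
  rw [← Real.log_le_iff_le_exp (by linarith)]
  linarith

theorem exp_neg_le_one_sub_half {x : ℝ} (hx0 : 0 ≤ x) (hx1 : x ≤ 1) :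
    Real.exp (-x) ≤ 1 - x / 2 := by
  rw [Real.exp_neg]
  refine inv_le_of_inv_le₀ (by linarith) ?_
  refine le_trans ?_ (Real.add_one_le_exp x)
  rw [inv_le_iff_one_le_mul₀ (by linarith)]
  nlinarith

/-- **Euler–Maruyama mean-decay gap for the OU process** (Section 5.2). For
every integer `k ≥ 1` and `η ∈ (0,1)` with `kη² ≤ 2`, one has
`e^{−kη} − (1−η)^k ≥ (1/4) k η² e^{−kη}`. -/
theorem exp_sub_one_sub_pow_ge
    (k : ℕ) (hk : 1 ≤ k) (η : ℝ) (hη0 : 0 < η) (hη1 : η < 1)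
    (hkη : (k : ℝ) * η ^ 2 ≤ 2) :
    Real.exp (-(k * η)) - (1 - η) ^ k ≥
      (1 / 4) * k * η ^ 2 * Real.exp (-(k * η)) := by
  have hpow : (1 - η) ^ k ≤ Real.exp (-(k * η)) * Real.exp (-(k * η ^ 2 / 2)) := by
    calc (1 - η) ^ k ≤ Real.exp (-η - η ^ 2 / 2) ^ k :=
          pow_le_pow_left₀ (by linarith) (one_sub_le_exp_neg_sub_sq_div_two hη0.le hη1) k
      _ = Real.exp (-(k * η)) * Real.exp (-(k * η ^ 2 / 2)) := by
          rw [← Real.exp_nat_mul, ← Real.exp_add]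
          ring_nf
  have hexp : Real.exp (-(k * η ^ 2 / 2)) ≤ 1 - k * η ^ 2 / 2 / 2 :=
    exp_neg_le_one_sub_half (by positivity) (by linarith)
  have := mul_le_mul_of_nonneg_left hexp (Real.exp_pos (-(k * η))).le
  linarith
end

section
/- Let 0 < a ≤ 1 and let Y be a real Gaussian random variable with mean −a/2 and variance a. Then E[(e^Y − 1 − Y)²] = e^a − 1 − a + a²/4, and consequently E[(e^Y − 1 − Y)²] ≤ a². -/
open MeasureTheory ProbabilityTheory

open scoped NNReal

lemma integrable_exp_mul_id_gaussianReal (μ t : ℝ) (v : ℝ≥0) :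
    Integrable (fun y ↦ y * Real.exp (t * y)) (gaussianReal μ v) := by
  simpa using integrable_pow_mul_exp_of_mem_interior_integrableExpSet (X := fun y : ℝ ↦ y)
    (μ := gaussianReal μ v) (v := t) (by simp [integrableExpSet_fun_id_gaussianReal]) 1

/-- Stein's identity for the exponential, obtained by differentiating the moment generating
function. -/
lemma integral_mul_exp_gaussianReal (μ t : ℝ) (v : ℝ≥0) :
    ∫ y, y * Real.exp (t * y) ∂(gaussianReal μ v)
      = (μ + v * t) * Real.exp (μ * t + v * t ^ 2 / 2) := by
  have h := hasDerivAt_mgf (X := fun y : ℝ ↦ y) (μ := gaussianReal μ v) (t := t)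
    (by simp [integrableExpSet_fun_id_gaussianReal])
  rw [mgf_fun_id_gaussianReal] at h
  have h' : HasDerivAt (fun t : ℝ ↦ Real.exp (μ * t + v * t ^ 2 / 2))
      (Real.exp (μ * t + v * t ^ 2 / 2) * (μ * 1 + v * (2 * t) / 2)) t := by
    refine (((hasDerivAt_id t).const_mul μ).add ?_).exp
    simpa using ((hasDerivAt_pow 2 t).const_mul (v : ℝ)).div_const 2
  rw [h.unique h']
  ring

lemma integral_exp_mul_gaussianReal (μ t : ℝ) (v : ℝ≥0) :
    ∫ y, Real.exp (t * y) ∂(gaussianReal μ v) = Real.exp (μ * t + v * t ^ 2 / 2) :=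
  congrFun (mgf_fun_id_gaussianReal (μ := μ) (v := v)) t

lemma integral_sq_gaussianReal (μ : ℝ) (v : ℝ≥0) :
    ∫ y, y ^ 2 ∂(gaussianReal μ v) = v + μ ^ 2 := by
  have h := variance_eq_sub (memLp_id_gaussianReal (μ := μ) (v := v) 2)
  rw [variance_id_gaussianReal] at h
  simp only [Pi.pow_apply, id_eq, integral_id_gaussianReal] at h
  linarith

lemma integral_sq_exp_sub_one_sub_gaussianReal (μ : ℝ) (v : ℝ≥0) :
    ∫ y, (Real.exp y - 1 - y) ^ 2 ∂(gaussianReal μ v)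
      = Real.exp (2 * μ + 2 * v) - 2 * (1 + μ + v) * Real.exp (μ + v / 2)
        + (1 + μ) ^ 2 + v := by
  have hexp (t : ℝ) := integrable_exp_mul_gaussianReal (μ := μ) (v := v) t
  have h2 := hexp 2
  have h1 := (hexp 1).const_mul 2
  have hm := (integrable_exp_mul_id_gaussianReal μ 1 v).const_mul 2
  have hid : Integrable (fun y : ℝ ↦ 2 * y) (gaussianReal μ v) :=
    ((memLp_id_gaussianReal (μ := μ) (v := v) 1).integrable (by simp)).const_mul 2
  have hsq : Integrable (fun y : ℝ ↦ y ^ 2) (gaussianReal μ v) :=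
    (memLp_id_gaussianReal (μ := μ) (v := v) 2).integrable_sq
  have hmean : ∫ y, 2 * y ∂(gaussianReal μ v) = 2 * μ := by
    rw [integral_const_mul (2 : ℝ) (fun y ↦ y), integral_id_gaussianReal]
  have hexpand (y : ℝ) : (Real.exp y - 1 - y) ^ 2
      = Real.exp (2 * y) - 2 * Real.exp (1 * y) - 2 * (y * Real.exp (1 * y))
        + 1 + 2 * y + y ^ 2 := by
    rw [two_mul y, Real.exp_add, one_mul]
    ring
  simp_rw [hexpand]
  rw [integral_add (by fun_prop) hsq, integral_add (by fun_prop) hid,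
    integral_add (by fun_prop) (by fun_prop), integral_sub (by fun_prop) hm, integral_sub h2 h1]
  simp only [integral_const_mul, integral_exp_mul_gaussianReal, integral_mul_exp_gaussianReal,
    integral_sq_gaussianReal, hmean, integral_const, probReal_univ, one_smul]
  ring_nf

lemma Real.exp_le_one_add_add_three_quarters_sq {x : ℝ} (h0 : 0 ≤ x) (h1 : x ≤ 1) :
    Real.exp x ≤ 1 + x + 3 / 4 * x ^ 2 := by
  have h := Real.exp_bound' h0 h1 (n := 3) (by norm_num)
  norm_num [Finset.sum_range_succ, Nat.factorial] at h
  nlinarith [mul_le_mul_of_nonneg_left h1 (sq_nonneg x)]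

/-- **Gaussian second moment of the exponential remainder** (core of
Lemma A.5). If `Y ~ N(−a/2, a)` with `0 < a ≤ 1`, then
`E[(e^Y − 1 − Y)²] = e^a − 1 − a + a²/4`, and consequently
`E[(e^Y − 1 − Y)²] ≤ a²`. -/
theorem gaussian_exp_remainder_sq
    (a : ℝ) (ha0 : 0 < a) (ha1 : a ≤ 1) :
    (∫ y, (Real.exp y - 1 - y) ^ 2 ∂(gaussianReal (-a / 2) a.toNNReal)
        = Real.exp a - 1 - a + a ^ 2 / 4) ∧
      ∫ y, (Real.exp y - 1 - y) ^ 2 ∂(gaussianReal (-a / 2) a.toNNReal)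
        ≤ a ^ 2 := by
  have h : ∫ y, (Real.exp y - 1 - y) ^ 2 ∂(gaussianReal (-a / 2) a.toNNReal)
      = Real.exp a - 1 - a + a ^ 2 / 4 := by
    rw [integral_sq_exp_sub_one_sub_gaussianReal, Real.coe_toNNReal a ha0.le,
      show 2 * (-a / 2) + 2 * a = a by ring, show -a / 2 + a / 2 = 0 by ring, Real.exp_zero]
    ring
  refine ⟨h, h.trans_le ?_⟩
  linarith [Real.exp_le_one_add_add_three_quarters_sq ha0.le ha1]
end
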